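/- For every positive integer k, the least dimension d such that the symmetric punctured interval tile k(1)k tiles ℤ^d is equal to min{k, 3}. That is: k(1)k tiles ℤ^{min{k,3}}, and k(1)k does not tile ℤ^{d} for any d < min{k,3}. -/

import Mathlib

/-- The one-dimensional tile `k(m)ℓ`: an interval of length `k`, a gap of
length `m`, and an interval of length `ℓ`. -/
def punctTile (k m l : ℕ) : Set ℤ :=
  {x : ℤ | (0 ≤ x ∧ x < (k : ℤ)) ∨ ((k : ℤ) + m ≤ x ∧ x < (k : ℤ) + m + l)}

/-- `P` is a copy of the one-dimensional tile `T` in `ℤ^d`: the image of `T`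
under `x ↦ v + x • e i` or `x ↦ v - x • e i` for some axis `i` and `v ∈ ℤ^d`. -/
def IsCopy (d : ℕ) (T : Set ℤ) (P : Set (Fin d → ℤ)) : Prop :=
  ∃ (v : Fin d → ℤ) (i : Fin d) (ε : ℤ), (ε = 1 ∨ ε = -1) ∧
    P = (fun x : ℤ => fun j : Fin d => v j + if j = i then ε * x else 0) '' T

/-- The one-dimensional tile `T` tiles the subset `S ⊆ ℤ^d`. -/
def Tiles (d : ℕ) (T : Set ℤ) (S : Set (Fin d → ℤ)) : Prop :=
  ∃ F : Set (Set (Fin d → ℤ)),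
    (∀ P ∈ F, IsCopy d T P) ∧ F.Pairwise Disjoint ∧ ⋃₀ F = S

/-- The one-dimensional tile `T` tiles `ℤ^d`. -/
def TilesZd (d : ℕ) (T : Set ℤ) : Prop := Tiles d T Set.univ

/-- Centres of the horizontal and vertical copies in a tiling of `ℤ²` by the symmetric punctured
interval with arms of length `k ≥ 3`: `H a b` and `V a b` say that the horizontal, respectively
vertical, copy with hole `(a, b)` is used. -/
structure PlaneTiling (k : ℤ) (H V : ℤ → ℤ → Prop) : Prop where
  three_le : 3 ≤ k
  cov : ∀ x y, (∃ c, H c y ∧ c - k ≤ x ∧ x ≤ c + k ∧ x ≠ c) ∨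
    (∃ c, V x c ∧ c - k ≤ y ∧ y ≤ c + k ∧ y ≠ c)
  hh : ∀ {a b y}, H a y → H b y → a = b ∨ a + 2 * k + 1 ≤ b ∨ b + 2 * k + 1 ≤ a
  vv : ∀ {x a b}, V x a → V x b → a = b ∨ a + 2 * k + 1 ≤ b ∨ b + 2 * k + 1 ≤ a
  hv : ∀ {a y x b}, H a y → V x b → a - k ≤ x → x ≤ a + k → x ≠ a →
    b - k ≤ y → y ≤ b + k → y ≠ b → False

namespace PlaneTiling

variable {k : ℤ} {H V : ℤ → ℤ → Prop}

theorem swap (T : PlaneTiling k H V) :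
    PlaneTiling k (fun a b => V b a) (fun a b => H b a) where
  three_le := T.three_le
  cov x y := (T.cov y x).symm
  hh := T.vv
  vv := T.hh
  hv h₁ h₂ h₃ h₄ h₅ h₆ h₇ h₈ := T.hv h₂ h₁ h₆ h₇ h₈ h₃ h₄ h₅

theorem shift (T : PlaneTiling k H V) (p q : ℤ) :
    PlaneTiling k (fun a b => H (a + p) (b + q)) (fun a b => V (a + p) (b + q)) where
  three_le := T.three_le
  cov x y := by
    rcases T.cov (x + p) (y + q) with ⟨c, h, h₁, h₂, h₃⟩ | ⟨c, h, h₁, h₂, h₃⟩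
    · exact .inl ⟨c - p, by simpa using h, by omega, by omega, by omega⟩
    · exact .inr ⟨c - q, by simpa using h, by omega, by omega, by omega⟩
  hh h₁ h₂ := by have := T.hh h₁ h₂; omega
  vv h₁ h₂ := by have := T.vv h₁ h₂; omega
  hv h₁ h₂ _ _ _ _ _ _ := by apply T.hv h₁ h₂ <;> omega

theorem flip (T : PlaneTiling k H V) :
    PlaneTiling k (fun a b => H (-a) b) (fun a b => V (-a) b) where
  three_le := T.three_le
  cov x y := by
    rcases T.cov (-x) y with ⟨c, h, h₁, h₂, h₃⟩ | ⟨c, h, h₁, h₂, h₃⟩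
    · exact .inl ⟨-c, by simpa using h, by omega, by omega, by omega⟩
    · exact .inr ⟨c, h, by omega, by omega, by omega⟩
  hh h₁ h₂ := by have := T.hh h₁ h₂; omega
  vv h₁ h₂ := T.vv h₁ h₂
  hv h₁ h₂ _ _ _ _ _ _ := by apply T.hv h₁ h₂ <;> omega

/-- A horizontal copy in row `y` avoids a column whose cell in that row is vertically covered. -/
theorem avoid_col (T : PlaneTiling k H V) {c y x b : ℤ} (h : H c y) (h' : V x b)
    (h₁ : b - k ≤ y) (h₂ : y ≤ b + k) (h₃ : y ≠ b) : x < c - k ∨ x = c ∨ c + k < x := by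
  by_contra hc
  exact T.hv h h' (by omega) (by omega) (by omega) h₁ h₂ h₃

/-- A vertical copy in column `x` avoids a row whose cell in that column is horizontally covered. -/
theorem avoid_row (T : PlaneTiling k H V) {x c a y : ℤ} (h : V x c) (h' : H a y)
    (h₁ : a - k ≤ x) (h₂ : x ≤ a + k) (h₃ : x ≠ a) : y < c - k ∨ y = c ∨ c + k < y := by
  by_contra hc
  exact T.hv h' h h₁ h₂ h₃ (by omega) (by omega) (by omega)

theorem fill_h (T : PlaneTiling k H V) {a b : ℤ} (h : H a b) :
    ∃ c, V a c ∧ c - k ≤ b ∧ b ≤ c + k ∧ b ≠ c := by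
  rcases T.cov a b with ⟨c, h', h₁, h₂, h₃⟩ | h'
  · have := T.hh h h'
    omega
  · exact h'

theorem fill_v (T : PlaneTiling k H V) {a b : ℤ} (h : V a b) :
    ∃ c, H c b ∧ c - k ≤ a ∧ a ≤ c + k ∧ a ≠ c :=
  T.swap.fill_h h

theorem not_both (T : PlaneTiling k H V) {a b : ℤ} (h : H a b) (h' : V a b) : False := by
  obtain ⟨c, h₁, h₂⟩ := T.fill_h h
  have := T.vv h' h₁
  omega

/-- Two long consecutive steps force the next step to be as long as possible. -/
theorem staircase_step (T : PlaneTiling k H V) {s u : ℤ} (hs : 2 ≤ s) (hsk : s ≤ k) (hu : 2 ≤ u)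
    (huk : u ≤ k) (h₀ : H 0 0) (h₁ : V 0 s) (h₂ : H u s) :
    V u (s + k) ∧ H (u + k) (s + k) ∧ ∀ x, 1 ≤ x → x < u → V x (s + k + 1) := by
  have hk := T.three_le
  have hV : V u (s + k) := by
    obtain ⟨c, h, l₁, l₂, l₃⟩ := T.fill_h h₂
    have e₀ := T.avoid_row h h₀ (by omega) (by omega) (by omega)
    rcases T.cov 1 (s - 1) with ⟨d, h', m₁, m₂, m₃⟩ | ⟨d, h', m₁, m₂, m₃⟩
    · have e₁ := T.avoid_col h' h₁ (by omega) (by omega) (by omega)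
      have e₂ := T.avoid_row h h' (by omega) (by omega) (by omega)
      obtain rfl : c = s + k := by omega
      exact h
    · have e₁ := T.avoid_row h' h₀ (by omega) (by omega) (by omega)
      have e₂ := T.avoid_row h' h₂ (by omega) (by omega) (by omega)
      omega
  have hC : ∀ x, 1 ≤ x → x < u → V x (s + k + 1) := by
    intro x hx hxu
    rcases T.cov x (s + 1) with ⟨d, h', m₁, m₂, m₃⟩ | ⟨d, h', m₁, m₂, m₃⟩
    · have e₁ := T.avoid_col h' h₁ (by omega) (by omega) (by omega)
      have e₂ := T.avoid_col h' hV (by omega) (by omega) (by omega)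
      omega
    · have e₁ := T.avoid_row h' h₀ (by omega) (by omega) (by omega)
      have e₂ := T.avoid_row h' h₂ (by omega) (by omega) (by omega)
      obtain rfl : d = s + k + 1 := by omega
      exact h'
  refine ⟨hV, ?_, hC⟩
  obtain ⟨c, h, l₁, l₂, l₃⟩ := T.fill_v hV
  have e₁ := T.avoid_col h (hC (u - 1) (by omega) (by omega)) (by omega) (by omega) (by omega)
  have e₂ : u - 2 < c - k ∨ u - 2 = c ∨ c + k < u - 2 := by
    by_cases hu2 : u = 2
    · subst hu2
      exact T.avoid_col h h₁ (by omega) (by omega) (by omega)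
    · exact T.avoid_col h (hC (u - 2) (by omega) (by omega)) (by omega) (by omega) (by omega)
  obtain rfl : c = u + k := by omega
  exact h


theorem staircase_step_h (T : PlaneTiling k H V) {a b s u : ℤ} (hs : 2 ≤ s) (hsk : s ≤ k)
    (hu : 2 ≤ u) (huk : u ≤ k) (h₀ : H a b) (h₁ : V a (b + s)) (h₂ : H (a + u) (b + s)) :
    V (a + u) (b + s + k) ∧ H (a + u + k) (b + s + k) ∧
      ∀ x, 1 ≤ x → x < u → V (a + x) (b + s + k + 1) := by
  have := (T.shift a b).staircase_step hs hsk hu huk (by simpa using h₀)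
    (by simpa [add_comm] using h₁) (by simpa [add_comm] using h₂)
  simpa only [show ∀ x, x + a = a + x by intro; ring, show s + k + b = b + s + k by ring,
    show a + (u + k) = a + u + k by ring, show s + k + 1 + b = b + s + k + 1 by ring] using this

theorem staircase_step_v (T : PlaneTiling k H V) {a b s u : ℤ} (hs : 2 ≤ s) (hsk : s ≤ k)
    (hu : 2 ≤ u) (huk : u ≤ k) (h₀ : V a b) (h₁ : H (a + s) b) (h₂ : V (a + s) (b + u)) :
    H (a + s + k) (b + u) ∧ V (a + s + k) (b + u + k) ∧
      ∀ y, 1 ≤ y → y < u → H (a + s + k + 1) (b + y) :=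
  T.swap.staircase_step_h hs hsk hu huk h₀ h₁ h₂

theorem no_longest_steps (T : PlaneTiling k H V) {a b : ℤ} (h₀ : H a b) (h₁ : V a (b + k))
    (h₂ : H (a + k) (b + k)) : False := by
  have hk := T.three_le
  have k2 : 2 ≤ k := by omega
  obtain ⟨v₁, h₃, C⟩ := T.staircase_step_h k2 le_rfl k2 le_rfl h₀ h₁ h₂
  obtain ⟨-, v₂, -⟩ := T.staircase_step_v k2 le_rfl k2 le_rfl h₁ h₂ v₁
  obtain ⟨-, h₄, E⟩ := T.staircase_step_h k2 le_rfl k2 le_rfl h₂ v₁ h₃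
  obtain ⟨-, v₃, -⟩ := T.staircase_step_v k2 le_rfl k2 le_rfl v₁ h₃ v₂
  obtain ⟨c, h, l₁, l₂, l₃⟩ := T.fill_v (E (k - 1) (by omega) (by omega))
  have e₁ := T.avoid_col h (C 1 (by omega) (by omega)) (by omega) (by omega) (by omega)
  have e₂ := T.avoid_col h v₂ (by omega) (by omega) (by omega)
  have e₃ := T.avoid_col h v₃ (by omega) (by omega) (by omega)
  omega

theorem no_long_steps_pos (T : PlaneTiling k H V) {s u : ℤ} (hs : 2 ≤ s) (hsk : s ≤ k)
    (hu : 2 ≤ u) (huk : u ≤ k) (h₀ : H 0 0) (h₁ : V 0 s) (h₂ : H u s) : False := by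
  obtain ⟨v, h, -⟩ := T.staircase_step hs hsk hu huk h₀ h₁ h₂
  exact T.no_longest_steps h₂ v h

theorem no_long_steps_h (T : PlaneTiling k H V) {a b c d : ℤ} (h₀ : H a b) (h₁ : V a d)
    (h₂ : H c d) (hs : d + 2 ≤ b ∨ b + 2 ≤ d) (hsk : b - k ≤ d ∧ d ≤ b + k)
    (hu : c + 2 ≤ a ∨ a + 2 ≤ c) (huk : a - k ≤ c ∧ c ≤ a + k) : False := by
  have key : ∀ {H V : ℤ → ℤ → Prop} (_ : PlaneTiling k H V) {a b c d : ℤ} (_ : H a b) (_ : V a d)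
      (_ : H c d) (_ : b + 2 ≤ d) (_ : d ≤ b + k) (_ : c + 2 ≤ a ∨ a + 2 ≤ c)
      (_ : a - k ≤ c ∧ c ≤ a + k), False := by
    intro H V T a b c d h₀ h₁ h₂ l₁ l₂ l₃ l₄
    rcases l₃ with l₃ | l₃
    · exact (T.shift a b).flip.no_long_steps_pos (s := d - b) (u := a - c) (by omega) (by omega)
        (by omega) (by omega) (by simpa using h₀) (by simpa using h₁) (by simpa using h₂)
    · exact (T.shift a b).no_long_steps_pos (s := d - b) (u := c - a) (by omega) (by omega)
        (by omega) (by omega) (by simpa using h₀) (by simpa using h₁) (by simpa using h₂)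
  rcases hs with hs | hs
  · exact key T.swap.flip.swap (a := a) (b := -b) (c := c) (d := -d) (by simpa using h₀)
      (by simpa using h₁) (by simpa using h₂) (by omega) (by omega) hu huk
  · exact key T h₀ h₁ h₂ hs hsk.2 hu huk

theorem no_long_steps_v (T : PlaneTiling k H V) {a b c d : ℤ} (h₀ : V a b) (h₁ : H d b)
    (h₂ : V d c) (hs : d + 2 ≤ a ∨ a + 2 ≤ d) (hsk : a - k ≤ d ∧ d ≤ a + k)
    (hu : c + 2 ≤ b ∨ b + 2 ≤ c) (huk : b - k ≤ c ∧ c ≤ b + k) : False :=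
  T.swap.no_long_steps_h h₀ h₁ h₂ hs hsk hu huk

/-- A step of length one and a longer step complete to a four-cycle. -/
theorem four_cycle_h (T : PlaneTiling k H V) {a b c d : ℤ} (h₀ : H a b) (h₁ : V a d) (h₂ : H c d)
    (hs : d = b + 1 ∨ b = d + 1) (hu : c + 2 ≤ a ∨ a + 2 ≤ c) (huk : a - k ≤ c ∧ c ≤ a + k) :
    V c b := by
  have hk := T.three_le
  obtain ⟨e, h, l₁, l₂, l₃⟩ := T.fill_h h₂
  by_cases he : e + 2 ≤ d ∨ d + 2 ≤ e
  · exact (T.no_long_steps_v h₁ h₂ h hu huk he (by omega)).elim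
  · have := T.avoid_row h h₀ (by omega) (by omega) (by omega)
    obtain rfl : e = b := by omega
    exact h

theorem four_cycle_v (T : PlaneTiling k H V) {a b c d : ℤ} (h₀ : V a b) (h₁ : H d b) (h₂ : V d c)
    (hs : d = a + 1 ∨ a = d + 1) (hu : c + 2 ≤ b ∨ b + 2 ≤ c) (huk : b - k ≤ c ∧ c ≤ b + k) :
    H a c :=
  T.swap.four_cycle_h h₀ h₁ h₂ hs hu huk

/-- Above a four-cycle of width `u`, the columns strictly between its vertical copies. -/
theorem four_cycle_above (T : PlaneTiling k H V) {u : ℤ} (huk : u ≤ k) (h₀ : H 0 0) (v₀ : V 0 1)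
    (h₁ : H u 1) (v₁ : V u 0) {j : ℤ} (hj : 1 ≤ j) (hju : j < u) : V j (k + 2) := by
  have hk := T.three_le
  rcases T.cov j 2 with ⟨c, h, l₁, l₂, l₃⟩ | ⟨c, h, l₁, l₂, l₃⟩
  · have e₁ := T.avoid_col h v₀ (by omega) (by omega) (by omega)
    have e₂ := T.avoid_col h v₁ (by omega) (by omega) (by omega)
    omega
  · have e₁ := T.avoid_row h h₀ (by omega) (by omega) (by omega)
    have e₂ := T.avoid_row h h₁ (by omega) (by omega) (by omega)
    obtain rfl : c = k + 2 := by omega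
    exact h

theorem four_cycle_below (T : PlaneTiling k H V) {u : ℤ} (huk : u ≤ k) (h₀ : H 0 0) (v₀ : V 0 1)
    (h₁ : H u 1) (v₁ : V u 0) {j : ℤ} (hj : 1 ≤ j) (hju : j < u) : V j (-k - 1) := by
  have hk := T.three_le
  rcases T.cov j (-1) with ⟨c, h, l₁, l₂, l₃⟩ | ⟨c, h, l₁, l₂, l₃⟩
  · have e₁ := T.avoid_col h v₀ (by omega) (by omega) (by omega)
    have e₂ := T.avoid_col h v₁ (by omega) (by omega) (by omega)
    omega
  · have e₁ := T.avoid_row h h₀ (by omega) (by omega) (by omega)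
    have e₂ := T.avoid_row h h₁ (by omega) (by omega) (by omega)
    obtain rfl : c = -k - 1 := by omega
    exact h

/-- To the right of a four-cycle, rows start immediately after its right vertical copy. -/
theorem four_cycle_right (T : PlaneTiling k H V) {u r c : ℤ} (hu : 2 ≤ u) (huk : u ≤ k)
    (h₀ : H 0 0) (v₀ : V 0 1) (h₁ : H u 1) (v₁ : V u 0) (hr : 2 ≤ r) (hrk : r ≤ k) (h : H c r)
    (l₁ : c - k ≤ u + 1) (l₂ : u + 1 ≤ c + k) (l₃ : u + 1 ≠ c) : H (u + k + 1) r := by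
  have hk := T.three_le
  have e₁ := T.avoid_col h v₁ (by omega) (by omega) (by omega)
  have e₂ := T.avoid_col h (T.four_cycle_above huk h₀ v₀ h₁ v₁ (j := u - 1) (by omega) (by omega))
    (by omega) (by omega) (by omega)
  obtain rfl : c = u + k + 1 := by omega
  exact h

theorem four_cycle_not_low (T : PlaneTiling k H V) {u : ℤ} (hu : 2 ≤ u) (huk : u ≤ k)
    (h₀ : H 0 0) (v₀ : V 0 1) (h₁ : H u 1) (v₁ : V u 0) (d₂ : H (u + k + 1) 2)
    (d₃ : H (u + k + 1) 3) (m : V (u + k + 1) 0) : False := by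
  have hk := T.three_le
  obtain ⟨n, hn, l₁, l₂, l₃⟩ := T.fill_v m
  obtain rfl : n = u + k + 2 := by
    by_contra hne
    by_cases hn2 : n + 2 ≤ u + k + 1 ∨ u + k + 1 + 2 ≤ n
    · exact T.no_long_steps_h d₂ m hn (by omega) (by omega) hn2 (by omega)
    · have := T.hh h₀ hn
      omega
  obtain ⟨w, hw, l₄, l₅, l₆⟩ := T.fill_h hn
  have e₁ := T.avoid_row hw d₂ (by omega) (by omega) (by omega)
  have e₂ := T.avoid_row hw d₃ (by omega) (by omega) (by omega)
  have q := T.four_cycle_v m hn hw (by omega) (by omega) (by omega)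
  rcases T.cov (u + 2) (-1) with ⟨c, h, m₁, m₂, m₃⟩ | ⟨c, h, m₁, m₂, m₃⟩
  · have e₃ := T.avoid_col h v₁ (by omega) (by omega) (by omega)
    have e₄ := T.avoid_col h m (by omega) (by omega) (by omega)
    have e₅ := T.avoid_col h (T.four_cycle_below huk h₀ v₀ h₁ v₁ (j := u - 1) (by omega)
      (by omega)) (by omega) (by omega) (by omega)
    have e₆ := T.avoid_col h hw (by omega) (by omega) (by omega)
    omega
  · have e₃ := T.avoid_row h hn (by omega) (by omega) (by omega)
    have e₄ := T.avoid_row h q (by omega) (by omega) (by omega)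
    omega

theorem four_cycle_not_h (T : PlaneTiling k H V) {u : ℤ} (hu : 2 ≤ u) (huk : u ≤ k)
    (h₀ : H 0 0) (v₀ : V 0 1) (h₁ : H u 1) (v₁ : V u 0) {a : ℤ} (ha : H a (k + 1))
    (l₁ : a - k ≤ u) (l₂ : u ≤ a + k) (l₃ : u ≠ a) : False := by
  have hk := T.three_le
  have C {j : ℤ} := @four_cycle_above _ _ _ T u huk h₀ v₀ h₁ v₁ j
  obtain rfl : a = u + k := by
    have e₁ := T.avoid_col ha (C (j := u - 1) (by omega) (by omega)) (by omega) (by omega)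
      (by omega)
    have e₂ : u - 2 < a - k ∨ u - 2 = a ∨ a + k < u - 2 := by
      by_cases hu2 : u = 2
      · subst hu2
        exact T.avoid_col ha v₀ (by omega) (by omega) (by omega)
      · exact T.avoid_col ha (C (j := u - 2) (by omega) (by omega)) (by omega) (by omega)
          (by omega)
    omega
  have D : ∀ r, 2 ≤ r → r ≤ k → H (u + k + 1) r := by
    intro r hr hrk
    rcases T.cov (u + 1) r with ⟨c, h, m₁, m₂, m₃⟩ | ⟨c, h, m₁, m₂, m₃⟩
    · exact T.four_cycle_right hu huk h₀ v₀ h₁ v₁ hr hrk h m₁ m₂ m₃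
    · have e₁ := T.avoid_row h h₁ (by omega) (by omega) (by omega)
      have e₂ := T.avoid_row h ha (by omega) (by omega) (by omega)
      omega
  have d₂ := D 2 (by omega) (by omega)
  have dk := D k (by omega) (by omega)
  obtain ⟨w, hw, m₁, m₂, m₃⟩ := T.fill_h ha
  obtain rfl : w = 2 * k + 1 := by
    have e₁ := T.avoid_row hw d₂ (by omega) (by omega) (by omega)
    have e₂ := T.avoid_row hw dk (by omega) (by omega) (by omega)
    omega
  obtain ⟨m, hm, m₄, m₅, m₆⟩ := T.fill_h dk
  have e₁ := T.avoid_row hm ha (by omega) (by omega) (by omega)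
  obtain rfl | rfl : m = 0 ∨ m = k + 1 := by omega
  · exact T.four_cycle_not_low hu huk h₀ v₀ h₁ v₁ d₂ (D 3 (by omega) (by omega)) hm
  · have hx := T.four_cycle_v hm ha hw (by omega) (by omega) (by omega)
    have hc := C (j := u - 1) (by omega) (by omega)
    rcases T.cov (u + k - 1) (k + 2) with ⟨c, h, n₁, n₂, n₃⟩ | ⟨c, h, n₁, n₂, n₃⟩
    · have e₂ := T.avoid_col h hw (by omega) (by omega) (by omega)
      have e₃ := T.avoid_col h hm (by omega) (by omega) (by omega)
      obtain rfl : c = u - 1 := by omega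
      exact T.not_both h hc
    · have e₂ := T.avoid_row h hx (by omega) (by omega) (by omega)
      have e₃ := T.avoid_row h ha (by omega) (by omega) (by omega)
      omega

theorem four_cycle_not_right (T : PlaneTiling k H V) {u : ℤ} (hu : 2 ≤ u) (huk : u ≤ k)
    (h₀ : H 0 0) (v₀ : V 0 1) (h₁ : H u 1) (v₁ : V u 0) (hJ : V u (2 * k + 1))
    (hK : H (u + k) (2 * k + 1)) : False := by
  have hk := T.three_le
  obtain ⟨f, hf, l₁, l₂, l₃⟩ := T.fill_h hK
  obtain rfl | rfl : f = 2 * k ∨ f = 2 * k + 2 := by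
    by_contra hne
    exact T.no_long_steps_v hJ hK hf (by omega) (by omega) (by omega) (by omega)
  · have key : ∀ r, k ≤ r → r < 2 * k → ∃ c, V (u + 1) c ∧ c - k ≤ r ∧ r ≤ c + k ∧ r ≠ c := by
      intro r hr hrk
      rcases T.cov (u + 1) r with ⟨c, h, m₁, m₂, m₃⟩ | h
      · have e₁ := T.avoid_col h hf (by omega) (by omega) (by omega)
        have e₂ : u < c - k ∨ u = c ∨ c + k < u := by
          by_cases hr : r = k
          · exact T.avoid_col h v₁ (by omega) (by omega) (by omega)
          · exact T.avoid_col h hJ (by omega) (by omega) (by omega)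
        omega
      · exact h
    obtain ⟨c, hc, m₁, m₂, m₃⟩ := key k le_rfl (by omega)
    obtain ⟨d, hd, m₄, m₅, m₆⟩ := key (2 * k - 1) (by omega) (by omega)
    have e₁ := T.avoid_row hc h₁ (by omega) (by omega) (by omega)
    have e₂ := T.avoid_row hc hK (by omega) (by omega) (by omega)
    have e₃ := T.avoid_row hd hK (by omega) (by omega) (by omega)
    have e₄ := T.vv hc hd
    omega
  · have hC : ∀ j, u < j → j < u + k → V j (2 * k + 1) := by
      intro j hj hjk
      rcases T.cov j (2 * k) with ⟨c, h, m₁, m₂, m₃⟩ | ⟨c, h, m₁, m₂, m₃⟩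
      · have e₁ := T.avoid_col h hf (by omega) (by omega) (by omega)
        have e₂ := T.avoid_col h hJ (by omega) (by omega) (by omega)
        omega
      · have e₁ := T.avoid_row h h₁ (by omega) (by omega) (by omega)
        have e₂ := T.avoid_row h hK (by omega) (by omega) (by omega)
        obtain rfl : c = 2 * k + 1 := by omega
        exact h
    have D : ∀ r, 2 ≤ r → r ≤ k → H (u + k + 1) r := by
      intro r hr hrk
      rcases T.cov (u + 1) r with ⟨c, h, m₁, m₂, m₃⟩ | ⟨c, h, m₁, m₂, m₃⟩
      · exact T.four_cycle_right hu huk h₀ v₀ h₁ v₁ hr hrk h m₁ m₂ m₃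
      · have e₁ := T.avoid_row h h₁ (by omega) (by omega) (by omega)
        have e₂ := T.vv h (hC (u + 1) (by omega) (by omega))
        omega
    have d₂ := D 2 (by omega) (by omega)
    have dk := D k (by omega) (by omega)
    have hO : H (u + 2 * k) (k + 1) := by
      rcases T.cov (u + k) (k + 1) with ⟨c, h, m₁, m₂, m₃⟩ | ⟨c, h, m₁, m₂, m₃⟩
      · have e₁ := T.avoid_col h (hC (u + k - 1) (by omega) (by omega)) (by omega) (by omega)
          (by omega)
        have e₂ := T.avoid_col h (hC (u + k - 2) (by omega) (by omega)) (by omega) (by omega)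
          (by omega)
        obtain rfl : c = u + 2 * k := by omega
        exact h
      · have e₁ := T.avoid_row h dk (by omega) (by omega) (by omega)
        have e₂ := T.vv h hf
        omega
    obtain ⟨m, hm, m₄, m₅, m₆⟩ := T.fill_h dk
    have e₁ := T.avoid_row hm hO (by omega) (by omega) (by omega)
    obtain rfl | rfl : m = 0 ∨ m = k + 1 := by omega
    · exact T.four_cycle_not_low hu huk h₀ v₀ h₁ v₁ d₂ (D 3 (by omega) (by omega)) hm
    · exact T.no_long_steps_h d₂ hm hO (by omega) (by omega) (by omega) (by omega)

theorem four_cycle_two_not_left (T : PlaneTiling k H V) (h₀ : H 0 0) (v₀ : V 0 1) (h₁ : H 2 1)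
    (v₁ : V 2 0) (hJ : V 2 (2 * k + 1)) (hK : H 1 (2 * k + 1)) : False := by
  have hk := T.three_le
  have hC := T.four_cycle_above (j := 1) (by omega) h₀ v₀ h₁ v₁ le_rfl (by omega)
  have hY := T.four_cycle_v hJ hK hC (by omega) (by omega) (by omega)
  have start : ∀ r c, 2 ≤ r → r ≤ 2 * k → r ≠ k + 2 → H c r → c - k ≤ 3 → 3 ≤ c + k → 3 ≠ c →
      H (k + 3) r := by
    intro r c hr hrk hr2 h m₁ m₂ m₃
    have e₁ : 2 < c - k ∨ 2 = c ∨ c + k < 2 := by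
      by_cases hr : r ≤ k
      · exact T.avoid_col h v₁ (by omega) (by omega) (by omega)
      · exact T.avoid_col h hJ (by omega) (by omega) (by omega)
    have e₂ := T.avoid_col h hC (by omega) (by omega) (by omega)
    obtain rfl : c = k + 3 := by omega
    exact h
  have D : ∀ r, 2 ≤ r → r ≤ k + 1 → H (k + 3) r := by
    intro r hr hrk
    rcases T.cov 3 r with ⟨c, h, m₁, m₂, m₃⟩ | ⟨c, h, m₁, m₂, m₃⟩
    · exact start r c hr (by omega) (by omega) h m₁ m₂ m₃
    · have e₀ := T.avoid_row h h₀ (by omega) (by omega) (by omega)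
      have e₁ := T.avoid_row h h₁ (by omega) (by omega) (by omega)
      have e₂ := T.avoid_row h hY (by omega) (by omega) (by omega)
      have e₃ := T.avoid_row h hK (by omega) (by omega) (by omega)
      omega
  have F : ∀ r, k + 3 ≤ r → r ≤ 2 * k → H (k + 3) r := by
    intro r hr hrk
    rcases T.cov 3 r with ⟨c, h, m₁, m₂, m₃⟩ | ⟨c, h, m₁, m₂, m₃⟩
    · exact start r c (by omega) (by omega) (by omega) h m₁ m₂ m₃
    · have e₂ := T.avoid_row h hY (by omega) (by omega) (by omega)
      have e₃ := T.avoid_row h hK (by omega) (by omega) (by omega)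
      omega
  obtain ⟨m, hm, l₁, l₂, l₃⟩ := T.fill_h (D 3 (by omega) (by omega))
  have a₁ : m < 2 ∨ k + 1 < m := by
    by_contra hm'
    exact T.not_both (D m (by omega) (by omega)) hm
  have far : ∀ {r m n : ℤ}, H (k + 3) r → V (k + 3) m → H n m → r - k ≤ m → m ≤ r + k →
      (r + 2 ≤ m ∨ m + 2 ≤ r) → n - k ≤ k + 3 → k + 3 ≤ n + k → k + 3 ≠ n →
      n = k + 2 ∨ n = k + 4 := by
    intro r m n hr hm hn b₁ b₂ b₃ b₄ b₅ b₆
    by_contra hne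
    exact T.no_long_steps_h hr hm hn (by omega) (by omega) (by omega) (by omega)
  obtain ⟨n, hn, n₁, n₂, n₃⟩ := T.fill_v hm
  obtain hm | hm | hm | hm : m = k + 3 ∨ m = k + 2 ∨ m = 1 ∨ m ≤ 0 := by omega
  · subst hm
    exact T.not_both (F (k + 3) le_rfl (by omega)) ‹_›
  · subst hm
    have := far (D 2 (by omega) (by omega)) ‹_› hn (by omega) (by omega) (by omega) n₁ n₂ n₃
    have := T.hh hn hY
    omega
  · subst hm
    have := far (D (k + 1) (by omega) (by omega)) ‹_› hn (by omega) (by omega) (by omega) n₁ n₂ n₃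
    have := T.hh hn h₁
    omega
  · obtain ⟨p, hp, p₁, p₂, p₃⟩ := T.fill_h (D (m + k + 1) (by omega) (by omega))
    have e := T.vv ‹V (k + 3) m› hp
    obtain rfl : p = m + 2 * k + 1 := by omega
    obtain ⟨q, hq, q₁, q₂, q₃⟩ := T.fill_v hp
    by_cases hm0 : m = 0
    · subst hm0
      have := far (D (k + 1) (by omega) (by omega)) hp hq (by omega) (by omega) (by omega) q₁ q₂ q₃
      have := T.hh (show H q (2 * k + 1) by simpa using hq) hK
      omega
    · exact T.not_both (F _ (by omega) (by omega)) hp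

theorem no_wide_four_cycle (T : PlaneTiling k H V) {u : ℤ} (hu : 2 ≤ u) (huk : u ≤ k)
    (h₀ : H 0 0) (v₀ : V 0 1) (h₁ : H u 1) (v₁ : V u 0) : False := by
  have hk := T.three_le
  have C {j : ℤ} := @four_cycle_above _ _ _ T u huk h₀ v₀ h₁ v₁ j
  rcases T.cov u (k + 1) with ⟨c, h, m₁, m₂, m₃⟩ | ⟨c, h, m₁, m₂, m₃⟩
  · exact T.four_cycle_not_h hu huk h₀ v₀ h₁ v₁ h m₁ m₂ m₃
  · have e := T.vv h v₁
    obtain rfl : c = 2 * k + 1 := by omega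
    obtain ⟨a, ha, l₁, l₂, l₃⟩ := T.fill_v h
    have e₁ := T.avoid_col ha (C (j := u - 1) (by omega) (by omega)) (by omega) (by omega)
      (by omega)
    by_cases hu2 : u = 2
    · subst hu2
      obtain rfl | rfl : a = 2 + k ∨ a = 1 := by omega
      · exact T.four_cycle_not_right hu huk h₀ v₀ h₁ v₁ h ha
      · exact T.four_cycle_two_not_left h₀ v₀ h₁ v₁ h ha
    · have e₂ := T.avoid_col ha (C (j := u - 2) (by omega) (by omega)) (by omega) (by omega)
        (by omega)
      obtain rfl : a = u + k := by omega
      exact T.four_cycle_not_right hu huk h₀ v₀ h₁ v₁ h ha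

theorem no_one_long_h (T : PlaneTiling k H V) {a b c d : ℤ} (h₀ : H a b) (h₁ : V a d) (h₂ : H c d)
    (hs : d = b + 1 ∨ b = d + 1) (hu : c + 2 ≤ a ∨ a + 2 ≤ c) (huk : a - k ≤ c ∧ c ≤ a + k) :
    False := by
  have key : ∀ {H V : ℤ → ℤ → Prop} (_ : PlaneTiling k H V) {a b c : ℤ} (_ : H a b)
      (_ : V a (b + 1)) (_ : H c (b + 1)) (_ : V c b) (_ : c + 2 ≤ a ∨ a + 2 ≤ c)
      (_ : a - k ≤ c ∧ c ≤ a + k), False := by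
    intro H V T a b c h₀ h₁ h₂ h₃ l₃ l₄
    rcases l₃ with l₃ | l₃
    · exact (T.shift a b).flip.no_wide_four_cycle (u := a - c) (by omega) (by omega)
        (by simpa using h₀) (by simpa [add_comm] using h₁) (by simpa [add_comm] using h₂)
        (by simpa using h₃)
    · exact (T.shift a b).no_wide_four_cycle (u := c - a) (by omega) (by omega)
        (by simpa using h₀) (by simpa [add_comm] using h₁) (by simpa [add_comm] using h₂)
        (by simpa using h₃)
  have h₃ := T.four_cycle_h h₀ h₁ h₂ hs hu huk
  rcases hs with rfl | rfl
  · exact key T h₀ h₁ h₂ h₃ hu huk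
  · exact key T.swap.flip.swap (a := a) (b := -(d + 1)) (c := c) (by simpa using h₀)
      (by simpa using h₁) (by simpa using h₂) (by simpa using h₃) hu huk

theorem no_one_long_v (T : PlaneTiling k H V) {a b c d : ℤ} (h₀ : V a b) (h₁ : H d b) (h₂ : V d c)
    (hs : d = a + 1 ∨ a = d + 1) (hu : c + 2 ≤ b ∨ b + 2 ≤ c) (huk : b - k ≤ c ∧ c ≤ b + k) :
    False :=
  T.swap.no_one_long_h h₀ h₁ h₂ hs hu huk

/-- Two steps of length one complete to a pinwheel. -/
theorem pinwheel_h (T : PlaneTiling k H V) {a b c d : ℤ} (h₀ : H a b) (h₁ : V a d) (h₂ : H c d)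
    (hs : d = b + 1 ∨ b = d + 1) (hu : c = a + 1 ∨ a = c + 1) : V c b := by
  have hk := T.three_le
  obtain ⟨e, h, l₁, l₂, l₃⟩ := T.fill_h h₂
  by_cases he : e + 2 ≤ d ∨ d + 2 ≤ e
  · exact (T.no_one_long_v h₁ h₂ h hu he (by omega)).elim
  · have := T.avoid_row h h₀ (by omega) (by omega) (by omega)
    obtain rfl : e = b := by omega
    exact h

theorem pinwheel_v (T : PlaneTiling k H V) {a b c d : ℤ} (h₀ : V a b) (h₁ : H d b) (h₂ : V d c)
    (hs : d = a + 1 ∨ a = d + 1) (hu : c = b + 1 ∨ b = c + 1) : H a c :=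
  T.swap.pinwheel_h h₀ h₁ h₂ hs hu

/-- A quarter turn about the centre of the unit square. -/
theorem turn (T : PlaneTiling k H V) :
    PlaneTiling k (fun a b => V b (1 - a)) (fun a b => H b (1 - a)) := by
  simpa [sub_eq_add_neg, add_comm] using T.swap.flip.shift (-1) 0

/-- A horizontal copy on top of the upper right arm of a pinwheel determines the rows next to that
arm. -/
theorem pinwheel_rows (T : PlaneTiling k H V) (v₀ : V 0 1) (h₁ : H 1 1) (v₁ : V 1 0) {a : ℤ}
    (ha : H a (k + 1)) (l₁ : a - k ≤ 1) (l₂ : 1 ≤ a + k) :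
    (a = 0 ∨ a = k + 1) ∧ ∀ r, 2 ≤ r → r ≤ k → H (k + 2) r := by
  have hk := T.three_le
  have e₀ := T.avoid_col ha v₀ (by omega) (by omega) (by omega)
  refine ⟨by omega, fun r hr hrk => ?_⟩
  rcases T.cov 2 r with ⟨c, h, m₁, m₂, m₃⟩ | ⟨c, h, m₁, m₂, m₃⟩
  · have e₁ := T.avoid_col h v₀ (by omega) (by omega) (by omega)
    have e₂ := T.avoid_col h v₁ (by omega) (by omega) (by omega)
    obtain rfl : c = k + 2 := by omega
    exact h
  · have e₁ := T.avoid_row h h₁ (by omega) (by omega) (by omega)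
    have e₂ := T.avoid_row h ha (by omega) (by omega) (by omega)
    omega

theorem pinwheel_not_far (T : PlaneTiling k H V) (h₀ : H 0 0) (v₀ : V 0 1) (h₁ : H 1 1)
    (v₁ : V 1 0) : ¬ H (k + 1) (k + 1) := by
  intro ha
  have hk := T.three_le
  obtain ⟨-, D⟩ := T.pinwheel_rows v₀ h₁ v₁ ha (by omega) (by omega)
  have d₂ := D 2 (by omega) (by omega)
  have dk := D k (by omega) (by omega)
  obtain ⟨w, hw, m₁, m₂, m₃⟩ := T.fill_h ha
  obtain rfl : w = 2 * k + 1 := by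
    have e₁ := T.avoid_row hw d₂ (by omega) (by omega) (by omega)
    have e₂ := T.avoid_row hw dk (by omega) (by omega) (by omega)
    omega
  obtain ⟨m, hm, m₄, m₅, m₆⟩ := T.fill_h dk
  have e₁ := T.avoid_row hm ha (by omega) (by omega) (by omega)
  obtain rfl | rfl : m = 0 ∨ m = k + 1 := by omega
  · obtain ⟨n, hn, l₁, l₂, l₃⟩ := T.fill_v hm
    have := T.hh h₀ hn
    exact T.no_long_steps_h d₂ hm hn (by omega) (by omega) (by omega) (by omega)
  · exact T.no_one_long_v hm ha hw (by omega) (by omega) (by omega)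

theorem pinwheel_not_near (T : PlaneTiling k H V) (h₀ : H 0 0) (v₀ : V 0 1) (h₁ : H 1 1)
    (v₁ : V 1 0) : ¬ H 0 (k + 1) := by
  intro ha
  have hk := T.three_le
  obtain ⟨-, D⟩ := T.pinwheel_rows v₀ h₁ v₁ ha (by omega) (by omega)
  have d₂ := D 2 (by omega) (by omega)
  have d₃ := D 3 (by omega) (by omega)
  have dk := D k (by omega) (by omega)
  have hR : H (2 * k + 1) 0 := by
    rcases T.cov (k + 1) 0 with ⟨c, h, l₁, l₂, l₃⟩ | ⟨c, h, l₁, l₂, l₃⟩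
    · have := T.hh h h₀
      obtain rfl : c = 2 * k + 1 := by omega
      exact h
    · have e₁ := T.avoid_row h h₁ (by omega) (by omega) (by omega)
      have e₂ := T.avoid_row h d₂ (by omega) (by omega) (by omega)
      obtain rfl : c = 1 - (k + 1) := by omega
      exact (T.turn.pinwheel_not_far (by simpa using v₀) (by simpa using h₁)
        (by simpa using v₁) (by simpa using h₀) h).elim
  obtain ⟨m, hm, l₁, l₂, l₃⟩ := T.fill_h d₂
  have e₁ := T.avoid_row hm hR (by omega) (by omega) (by omega)
  obtain ⟨n, hn, m₁, m₂, m₃⟩ := T.fill_v hm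
  have e₂ : n = k + 1 ∨ n = k + 3 := by
    by_contra hne
    exact T.no_long_steps_h d₂ hm hn (by omega) (by omega) (by omega) (by omega)
  obtain rfl | rfl | rfl : m = 0 ∨ m = k + 1 ∨ m = k + 2 := by omega
  · have := T.hh hR hn
    omega
  · have := T.hh ha hn
    omega
  · have e₃ : n = k + 1 := by
      by_contra hne
      rcases T.cov (k + 1) (k + 1) with ⟨c, h, n₁, n₂, n₃⟩ | ⟨c, h, n₁, n₂, n₃⟩
      · have e₄ := T.avoid_col h hm (by omega) (by omega) (by omega)
        have e₅ := T.hh ha h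
        omega
      · have e₄ := T.avoid_row h dk (by omega) (by omega) (by omega)
        have e₅ := T.avoid_row h hn (by omega) (by omega) (by omega)
        omega
    subst e₃
    obtain ⟨p, hp, p₁, p₂, p₃⟩ := T.fill_h hn
    have e₄ := T.avoid_row hp d₃ (by omega) (by omega) (by omega)
    have e₅ := T.avoid_row hp dk (by omega) (by omega) (by omega)
    have e₆ := T.avoid_row hp d₂ (by omega) (by omega) (by omega)
    exact T.no_one_long_v hm hn hp (by omega) (by omega) (by omega)

/-- Both vertical copies of a pinwheel are continued by further vertical copies. -/
theorem pinwheel_top (T : PlaneTiling k H V) (h₀ : H 0 0) (v₀ : V 0 1) (h₁ : H 1 1)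
    (v₁ : V 1 0) : V 1 (2 * k + 1) := by
  have hk := T.three_le
  rcases T.cov 1 (k + 1) with ⟨c, h, l₁, l₂, l₃⟩ | ⟨c, h, l₁, l₂, l₃⟩
  · obtain ⟨rfl | rfl, -⟩ := T.pinwheel_rows v₀ h₁ v₁ h l₁ l₂
    · exact (T.pinwheel_not_near h₀ v₀ h₁ v₁ h).elim
    · exact (T.pinwheel_not_far h₀ v₀ h₁ v₁ h).elim
  · have := T.vv h v₁
    obtain rfl : c = 2 * k + 1 := by omega
    exact h

theorem no_pinwheel (T : PlaneTiling k H V) (h₀ : H 0 0) (v₀ : V 0 1) (h₁ : H 1 1)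
    (v₁ : V 1 0) : False := by
  have hk := T.three_le
  have hJ := T.pinwheel_top h₀ v₀ h₁ v₁
  have hR : H (2 * k + 1) 0 := by
    simpa using T.turn.pinwheel_top (by simpa using v₀) (by simpa using h₁)
      (by simpa using v₁) (by simpa using h₀)
  rcases T.cov 2 2 with ⟨c, h, l₁, l₂, l₃⟩ | ⟨c, h, l₁, l₂, l₃⟩
  · have e₀ := T.avoid_col h v₀ (by omega) (by omega) (by omega)
    have e₁ := T.avoid_col h v₁ (by omega) (by omega) (by omega)
    obtain rfl : c = k + 2 := by omega
    obtain ⟨m, hm, m₁, m₂, m₃⟩ := T.fill_h h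
    have e₂ := T.avoid_row hm hR (by omega) (by omega) (by omega)
    obtain ⟨n, hn, n₁, n₂, n₃⟩ := T.fill_v hm
    have e₃ : n = k + 1 ∨ n = k + 3 := by
      by_contra hne
      exact T.no_long_steps_h h hm hn (by omega) (by omega) (by omega) (by omega)
    obtain rfl | hm0 : m = 0 ∨ k + 1 ≤ m := by omega
    · have := T.hh hR hn
      omega
    have e₄ := T.avoid_col hn hJ (by omega) (by omega) (by omega)
    obtain rfl : n = k + 3 := by omega
    obtain ⟨p, hp, p₁, p₂, p₃⟩ := T.fill_h hn
    have e₅ := T.avoid_row hp h (by omega) (by omega) (by omega)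
    have e₆ : p = m - 1 ∨ p = m + 1 := by
      by_contra hne
      exact T.no_one_long_v hm hn hp (by omega) (by omega) (by omega)
    obtain ⟨rfl, rfl⟩ : m = k + 2 ∧ p = k + 2 + 1 := by omega
    have hq := T.pinwheel_v hm hn hp (by omega) (by omega)
    have hx : V 2 (k + 3) := by
      rcases T.cov 2 (k + 2) with ⟨d, h', q₁, q₂, q₃⟩ | ⟨d, h', q₁, q₂, q₃⟩
      · have a₁ := T.avoid_col h' hJ (by omega) (by omega) (by omega)
        have a₂ := T.hh h' hn
        omega
      · have a₁ := T.avoid_row h' hq (by omega) (by omega) (by omega)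
        have a₂ := T.avoid_row h' h₁ (by omega) (by omega) (by omega)
        obtain rfl : d = k + 3 := by omega
        exact h'
    rcases T.cov 3 3 with ⟨d, h', q₁, q₂, q₃⟩ | ⟨d, h', q₁, q₂, q₃⟩
    · have a₁ := T.avoid_col h' hx (by omega) (by omega) (by omega)
      have a₂ := T.avoid_col h' hm (by omega) (by omega) (by omega)
      omega
    · have a₁ := T.avoid_row h' h (by omega) (by omega) (by omega)
      have a₂ := T.avoid_row h' hn (by omega) (by omega) (by omega)
      omega
  · have e₀ := T.avoid_row h h₀ (by omega) (by omega) (by omega)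
    have e₁ := T.avoid_row h h₁ (by omega) (by omega) (by omega)
    obtain rfl : c = k + 2 := by omega
    obtain ⟨a, ha, m₁, m₂, m₃⟩ := T.fill_v h
    have e₂ := T.avoid_col ha hJ (by omega) (by omega) (by omega)
    obtain rfl | rfl : a = 1 ∨ a = k + 2 := by omega
    · exact T.no_one_long_v h ha hJ (by omega) (by omega) (by omega)
    obtain ⟨l, hl, n₁, n₂, n₃⟩ := T.fill_h ha
    have hl' : l = k + 1 ∨ l = k + 3 := by
      by_contra hne
      exact T.no_long_steps_v h ha hl (by omega) (by omega) (by omega) (by omega)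
    obtain ⟨d, hd, hd'⟩ : ∃ d, V (k + 1) d ∧ (d = 1 ∨ d = k + 2) := by
      rcases T.cov (k + 1) 3 with ⟨d, h', q₁, q₂, q₃⟩ | ⟨d, h', q₁, q₂, q₃⟩
      · have a₁ := T.avoid_col h' h (by omega) (by omega) (by omega)
        have a₂ := T.avoid_col h' hl (by omega) (by omega) (by omega)
        omega
      · have a₁ := T.avoid_row h' h₁ (by omega) (by omega) (by omega)
        have a₂ := T.avoid_row h' ha (by omega) (by omega) (by omega)
        exact ⟨d, h', by omega⟩
    obtain ⟨n, hn, q₁, q₂, q₃⟩ := T.fill_v hl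
    have e₃ := T.avoid_col hn hJ (by omega) (by omega) (by omega)
    have e₄ : n = k + 3 := by
      by_contra hne
      exact T.no_one_long_h ha hl hn (by omega) (by omega) (by omega)
    obtain rfl | rfl := hl'
    · have a₁ := T.avoid_col hn hd (by omega) (by omega) (by omega)
      omega
    · subst e₄
      have hx := T.pinwheel_h ha hl hn (by omega) (by omega)
      rcases T.cov (k + 2) 2 with ⟨p, h', p₁, p₂, p₃⟩ | ⟨p, h', p₁, p₂, p₃⟩
      · have a₁ := T.avoid_col h' hd (by omega) (by omega) (by omega)
        have a₂ := T.avoid_col h' hx (by omega) (by omega) (by omega)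
        omega
      · have a₁ := T.avoid_row h' hR (by omega) (by omega) (by omega)
        have a₂ := T.vv h' hl
        omega

theorem no_short_steps (T : PlaneTiling k H V) {a b c d : ℤ} (h₀ : H a b) (h₁ : V a d)
    (h₂ : H c d) (hs : d = b + 1 ∨ b = d + 1) (hu : c = a + 1 ∨ a = c + 1) : False := by
  have key : ∀ {H V : ℤ → ℤ → Prop} (_ : PlaneTiling k H V) {a b c : ℤ} (_ : H a b)
      (_ : V a (b + 1)) (_ : H c (b + 1)) (_ : V c b) (_ : c = a + 1 ∨ a = c + 1), False := by
    intro H V T a b c h₀ h₁ h₂ h₃ hu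
    rcases hu with rfl | rfl
    · exact (T.shift a b).no_pinwheel (by simpa using h₀) (by simpa [add_comm] using h₁)
        (by simpa [add_comm] using h₂) (by simpa [add_comm] using h₃)
    · exact (T.shift (c + 1) b).flip.no_pinwheel (by simpa using h₀)
        (by simpa [add_comm] using h₁) (by simpa [add_comm] using h₂) (by simpa using h₃)
  have h₃ := T.pinwheel_h h₀ h₁ h₂ hs hu
  rcases hs with rfl | rfl
  · exact key T h₀ h₁ h₂ h₃ hu
  · exact key T.swap.flip.swap (a := a) (b := -(d + 1)) (c := c) (by simpa using h₀)
      (by simpa using h₁) (by simpa using h₂) (by simpa using h₃) hu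

theorem no_horizontal (T : PlaneTiling k H V) {a b : ℤ} (h₀ : H a b) : False := by
  have hk := T.three_le
  obtain ⟨c, h₁, l₁, l₂, l₃⟩ := T.fill_h h₀
  obtain ⟨d, h₂, m₁, m₂, m₃⟩ := T.fill_v h₁
  obtain ⟨e, h₃, n₁, n₂, n₃⟩ := T.fill_h h₂
  by_cases hc : c = b + 1 ∨ b = c + 1
  · by_cases hd : d = a + 1 ∨ a = d + 1
    · exact T.no_short_steps h₀ h₁ h₂ hc hd
    · exact T.no_one_long_h h₀ h₁ h₂ hc (by omega) (by omega)
  · by_cases hd : d = a + 1 ∨ a = d + 1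
    · by_cases he : e = c + 1 ∨ c = e + 1
      · exact T.swap.no_short_steps h₁ h₂ h₃ hd he
      · exact T.no_one_long_v h₁ h₂ h₃ hd (by omega) (by omega)
    · exact T.no_long_steps_h h₀ h₁ h₂ (by omega) (by omega) (by omega) (by omega)

theorem false (T : PlaneTiling k H V) : False := by
  rcases T.cov 0 0 with ⟨c, h, -⟩ | ⟨c, h, -⟩
  · exact T.no_horizontal h
  · exact T.swap.no_horizontal h

end PlaneTiling

/-- The copy of `k(1)k` along the axis `i` whose hole is `c`. -/
def centredCopy {d : ℕ} (k : ℕ) (i : Fin d) (c : Fin d → ℤ) : Set (Fin d → ℤ) :=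
  {p | (∀ j, j ≠ i → p j = c j) ∧ c i - k ≤ p i ∧ p i ≤ c i + k ∧ p i ≠ c i}

theorem IsCopy.exists_eq_centredCopy {d k : ℕ} {P : Set (Fin d → ℤ)}
    (h : IsCopy d (punctTile k 1 k) P) : ∃ i c, P = centredCopy k i c := by
  obtain ⟨v, i, ε, hε, rfl⟩ := h
  refine ⟨i, fun j => v j + if j = i then ε * k else 0, ?_⟩
  ext p
  simp only [centredCopy, punctTile, Set.mem_image, Set.mem_ofPred_eq, if_true, Nat.cast_one]
  constructor
  · rintro ⟨x, hx, rfl⟩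
    refine ⟨fun j hj => by simp [hj], ?_⟩
    rcases hε with rfl | rfl <;> simp only [if_true] <;> omega
  · rintro ⟨h₀, h₁⟩
    refine ⟨ε * (p i - v i), ?_, funext fun j => ?_⟩
    · rcases hε with rfl | rfl <;> omega
    · by_cases hj : j = i
      · subst hj
        rcases hε with rfl | rfl <;> simp
      · simp [h₀ j hj, hj]

/-- Two copies of `k(1)k` on a line with distinct but nearby holes intersect. -/
theorem exists_mem_both_of_near {k a b : ℤ} (hk : 2 ≤ k) (hab : a ≠ b) (h₁ : a < b + 2 * k + 1)
    (h₂ : b < a + 2 * k + 1) :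
    ∃ x, (a - k ≤ x ∧ x ≤ a + k ∧ x ≠ a) ∧ b - k ≤ x ∧ x ≤ b + k ∧ x ≠ b := by
  wlog h : a < b generalizing a b
  · obtain ⟨x, hx⟩ := this hab.symm h₂ h₁ (by omega)
    exact ⟨x, hx.symm⟩
  · by_cases h' : b ≤ a + k
    · by_cases h'' : b = a + 1
      · exact ⟨a + 2, by omega⟩
      · exact ⟨a + 1, by omega⟩
    · exact ⟨b - k, by omega⟩

theorem not_tilesZd_zero (T : Set ℤ) : ¬ TilesZd 0 T := by
  rintro ⟨F, hF, -, hU⟩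
  obtain ⟨P, hP, -⟩ := hU.symm ▸ Set.mem_univ (0 : Fin 0 → ℤ)
  obtain ⟨-, i, -⟩ := hF P hP
  exact i.elim0

theorem not_tilesZd_one {k : ℕ} (hk : 2 ≤ k) : ¬ TilesZd 1 (punctTile k 1 k) := by
  rintro ⟨F, hF, hD, hU⟩
  have cov : ∀ x : ℤ, ∃ c : Fin 1 → ℤ, centredCopy k 0 c ∈ F ∧ (fun _ => x) ∈ centredCopy k 0 c := by
    intro x
    obtain ⟨P, hP, hx⟩ := hU.symm ▸ Set.mem_univ (fun _ : Fin 1 => x)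
    obtain ⟨i, c, rfl⟩ := (hF P hP).exists_eq_centredCopy
    obtain rfl : i = 0 := Subsingleton.elim _ _
    exact ⟨c, hP, hx⟩
  obtain ⟨a, ha, -⟩ := cov 0
  obtain ⟨b, hb, hab⟩ := cov (a 0)
  have hab' := hab
  simp only [centredCopy, Set.mem_ofPred_eq] at hab'
  obtain ⟨x, hx, hx'⟩ := exists_mem_both_of_near (k := k) (a := a 0) (b := b 0) (by omega)
    (by omega) (by omega) (by omega)
  have hs : ∀ j : Fin 1, j ≠ 0 → ∀ y z : ℤ, y = z := fun j hj => (hj (Subsingleton.elim _ _)).elim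
  have e : centredCopy k 0 a = centredCopy k 0 b := hD.eq ha hb <| Set.not_disjoint_iff.2
    ⟨fun _ => x, ⟨fun j hj => hs j hj _ _, hx⟩, fun j hj => hs j hj _ _, hx'⟩
  rw [← e] at hab
  exact hab.2.2.2 rfl

theorem mem_centredCopy_zero {k : ℕ} {a b x y : ℤ} :
    ![x, y] ∈ centredCopy k 0 ![a, b] ↔ y = b ∧ a - k ≤ x ∧ x ≤ a + k ∧ x ≠ a := by
  simp [centredCopy]

theorem mem_centredCopy_one {k : ℕ} {a b x y : ℤ} :
    ![x, y] ∈ centredCopy k 1 ![a, b] ↔ x = a ∧ b - k ≤ y ∧ y ≤ b + k ∧ y ≠ b := by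
  simp [centredCopy]

theorem not_tilesZd_two {k : ℕ} (hk : 3 ≤ k) : ¬ TilesZd 2 (punctTile k 1 k) := by
  rintro ⟨F, hF, hD, hU⟩
  refine PlaneTiling.false (k := k) (H := fun a b => centredCopy k 0 ![a, b] ∈ F)
    (V := fun a b => centredCopy k 1 ![a, b] ∈ F) ⟨by omega, fun x y => ?_, fun {a b y} ha hb => ?_,
      fun {x a b} ha hb => ?_, fun {a y x b} ha hb h₁ h₂ h₃ h₄ h₅ h₆ => ?_⟩
  · obtain ⟨P, hP, hx⟩ := hU.symm ▸ Set.mem_univ ![x, y]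
    obtain ⟨i, c, rfl⟩ := (hF P hP).exists_eq_centredCopy
    obtain ⟨a, b, rfl⟩ : ∃ a b, c = ![a, b] := ⟨c 0, c 1, by ext j; fin_cases j <;> rfl⟩
    fin_cases i
    · obtain ⟨rfl, h⟩ := mem_centredCopy_zero.1 hx
      exact .inl ⟨a, hP, h⟩
    · obtain ⟨rfl, h⟩ := mem_centredCopy_one.1 hx
      exact .inr ⟨b, hP, h⟩
  · by_contra hc
    obtain ⟨x, hx, hx'⟩ := exists_mem_both_of_near (k := k) (a := a) (b := b) (by omega)
      (by omega) (by omega) (by omega)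
    have e : centredCopy k 0 ![a, y] = centredCopy k 0 ![b, y] := hD.eq ha hb <| Set.not_disjoint_iff.2
      ⟨![x, y], (mem_centredCopy_zero.2 ⟨rfl, hx⟩), (mem_centredCopy_zero.2 ⟨rfl, hx'⟩)⟩
    have h₁ : ![a - k, y] ∈ centredCopy k 0 ![a, y] := mem_centredCopy_zero.2 (by omega)
    have h₂ : ![b - k, y] ∈ centredCopy k 0 ![b, y] := mem_centredCopy_zero.2 (by omega)
    rw [e, mem_centredCopy_zero] at h₁
    rw [← e, mem_centredCopy_zero] at h₂
    omega
  · by_contra hc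
    obtain ⟨y, hy, hy'⟩ := exists_mem_both_of_near (k := k) (a := a) (b := b) (by omega)
      (by omega) (by omega) (by omega)
    have e : centredCopy k 1 ![x, a] = centredCopy k 1 ![x, b] := hD.eq ha hb <| Set.not_disjoint_iff.2
      ⟨![x, y], (mem_centredCopy_one.2 ⟨rfl, hy⟩), (mem_centredCopy_one.2 ⟨rfl, hy'⟩)⟩
    have h₁ : ![x, a - k] ∈ centredCopy k 1 ![x, a] := mem_centredCopy_one.2 (by omega)
    have h₂ : ![x, b - k] ∈ centredCopy k 1 ![x, b] := mem_centredCopy_one.2 (by omega)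
    rw [e, mem_centredCopy_one] at h₁
    rw [← e, mem_centredCopy_one] at h₂
    omega
  · have e : centredCopy k 0 ![a, y] = centredCopy k 1 ![x, b] := hD.eq ha hb <| Set.not_disjoint_iff.2
      ⟨![x, y], mem_centredCopy_zero.2 ⟨rfl, h₁, h₂, h₃⟩, mem_centredCopy_one.2 ⟨rfl, h₄, h₅, h₆⟩⟩
    have m₁ : ![a - k, y] ∈ centredCopy k 0 ![a, y] := mem_centredCopy_zero.2 (by omega)
    have m₂ : ![a + k, y] ∈ centredCopy k 0 ![a, y] := mem_centredCopy_zero.2 (by omega)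
    rw [e, mem_centredCopy_one] at m₁ m₂
    omega

/-- The set `S` of integers is a disjoint union of translates of `T`. -/
def LineTiles (T S : Set ℤ) : Prop :=
  ∃ A : Set ℤ, (∀ a ∈ A, ∀ t ∈ T, a + t ∈ S) ∧ (∀ x ∈ S, ∃ a ∈ A, x - a ∈ T) ∧
    ∀ x, ∀ a ∈ A, ∀ b ∈ A, x - a ∈ T → x - b ∈ T → a = b

theorem lineTiles_of_forall_notMem {T S : Set ℤ} (h : ∀ x, x ∉ S) : LineTiles T S :=
  ⟨∅, by simpa using fun x hx => h x hx⟩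

/-- Assign a direction to every point. If on each line the points assigned to the direction of
the line are tiled by translates of `T`, then `T` tiles the whole space. -/
theorem tilesZd_of_direction {d : ℕ} {T : Set ℤ} (δ : (Fin d → ℤ) → Fin d)
    (h : ∀ i p, LineTiles T {t | δ (Function.update p i t) = i}) : TilesZd d T := by
  choose A hA hcov huniq using h
  refine ⟨{P | ∃ i p, ∃ a ∈ A i (Function.update p i 0),
    P = (fun t => Function.update p i (a + t)) '' T}, ?_, ?_, ?_⟩
  · rintro P ⟨i, p, a, -, rfl⟩
    refine ⟨Function.update p i a, i, 1, .inl rfl, ?_⟩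
    refine congrArg (· '' T) (funext fun t => funext fun j => ?_)
    by_cases hj : j = i
    · subst hj
      simp
    · simp [hj]
  · have key : ∀ i p a t, a ∈ A i (Function.update p i 0) → t ∈ T →
        δ (Function.update p i (a + t)) = i := by
      intro i p a t ha ht
      simpa using hA i _ a ha t ht
    rintro P ⟨i, p, a, ha, rfl⟩ Q ⟨j, q, b, hb, rfl⟩ hne
    rw [Set.disjoint_iff_forall_ne]
    rintro _ ⟨t, ht, rfl⟩ _ ⟨u, hu, rfl⟩ heq
    refine hne ?_
    have hi := key i p a t ha ht
    simp only at heq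
    rw [heq, key j q b u hb hu] at hi
    subst hi
    have h₀ : Function.update p j 0 = Function.update q j 0 := by
      simpa using congrArg (fun f => Function.update f j (0 : ℤ)) heq
    have h₁ : a + t = b + u := by simpa using congrFun heq j
    rw [← h₀] at hb
    obtain rfl : a = b := huniq j _ (a + t) a ha b hb (by simpa using ht)
      (by rw [h₁]; simpa using hu)
    refine congrArg (· '' T) (funext fun s => ?_)
    simpa using congrArg (fun f => Function.update f j (a + s)) h₀
  · refine Set.eq_univ_of_forall fun p => ?_
    obtain ⟨a, ha, ht⟩ := hcov (δ p) (Function.update p (δ p) 0) (p (δ p)) (by simp)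
    exact ⟨_, ⟨δ p, p, a, ha, rfl⟩, p (δ p) - a, ht, by simp⟩

/-- The translates of `T` by the integers congruent to `c` modulo `N`. -/
theorem lineTiles_periodic {T S : Set ℤ} {N : ℤ} (c : ℤ) (hT : ∀ t ∈ T, 0 ≤ t ∧ t < N)
    (hS : ∀ x, x ∈ S ↔ (x - c) % N ∈ T) : LineTiles T S := by
  have key : ∀ x a, N ∣ a - c → x - a ∈ T → (x - c) % N = x - a := by
    rintro x a ⟨q, hq⟩ hx
    obtain ⟨h₀, h₁⟩ := hT _ hx
    rw [show x - c = x - a + N * q by omega, Int.add_mul_emod_self_left, Int.emod_eq_of_lt h₀ h₁]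
  refine ⟨{a | N ∣ a - c}, fun a ha t ht => ?_, fun x hx => ?_, fun x a ha b hb hxa hxb => ?_⟩
  · rw [hS, key (a + t) a ha (by simpa using ht)]
    simpa using ht
  · refine ⟨x - (x - c) % N, ?_, by simpa using (hS x).1 hx⟩
    rw [Set.mem_ofPred_eq, show x - (x - c) % N - c = (x - c) - (x - c) % N by ring]
    exact Int.dvd_self_sub_emod
  · have h₁ := key x a ha hxa
    have h₂ := key x b hb hxb
    omega

theorem LineTiles.union {T S S' : Set ℤ} (h : LineTiles T S) (h' : LineTiles T S')
    (hd : ∀ x ∈ S, x ∉ S') : LineTiles T (S ∪ S') := by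
  obtain ⟨A, hA, hc, hu⟩ := h
  obtain ⟨B, hB, hc', hu'⟩ := h'
  have key : ∀ x, ∀ a ∈ A, ∀ b ∈ B, x - a ∈ T → x - b ∈ T → False := fun x a ha b hb hxa hxb =>
    hd x (by simpa using hA a ha _ hxa) (by simpa using hB b hb _ hxb)
  refine ⟨A ∪ B, ?_, ?_, ?_⟩
  · rintro a (ha | ha) t ht
    exacts [.inl (hA a ha t ht), .inr (hB a ha t ht)]
  · rintro x (hx | hx)
    · obtain ⟨a, ha, ht⟩ := hc x hx
      exact ⟨a, .inl ha, ht⟩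
    · obtain ⟨a, ha, ht⟩ := hc' x hx
      exact ⟨a, .inr ha, ht⟩
  · rintro x a (ha | ha) b (hb | hb) hxa hxb
    exacts [hu x a ha b hb hxa hxb, (key x a ha b hb hxa hxb).elim,
      (key x b hb a ha hxb hxa).elim, hu' x a ha b hb hxa hxb]

theorem mem_punctTile {k : ℕ} {x : ℤ} :
    x ∈ punctTile k 1 k ↔ 0 ≤ x ∧ x ≤ 2 * k ∧ x ≠ k := by
  simp only [punctTile, Set.mem_ofPred_eq]
  omega

theorem tilesZd_one : TilesZd 1 (punctTile 1 1 1) := by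
  refine tilesZd_of_direction (fun _ => 0) fun i p => ?_
  obtain rfl : 0 = i := Subsingleton.elim _ _
  refine ⟨{a | a % 4 = 0 ∨ a % 4 = 1}, by simp, fun x _ => ?_, fun x a ha b hb hxa hxb => ?_⟩
  · simp only [mem_punctTile, Set.mem_ofPred_eq]
    by_cases h : x % 4 ≤ 1
    · exact ⟨x, by omega⟩
    · exact ⟨x - 2, by omega⟩
  · simp only [mem_punctTile, Set.mem_ofPred_eq] at *
    omega

theorem sub_emod_cases {N c x : ℤ} (h₀ : 0 ≤ c) (h₁ : c < N) :
    (x - c) % N = x % N - c ∧ c ≤ x % N ∨ (x - c) % N = x % N - c + N ∧ x % N < c := by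
  have hr := Int.emod_nonneg x (by omega : N ≠ 0)
  have hr' := Int.emod_lt_of_pos x (by omega : 0 < N)
  have e := Int.emod_add_mul_ediv x N
  by_cases h : c ≤ x % N
  · refine .inl ⟨?_, h⟩
    rw [show x - c = x % N - c + N * (x / N) by omega, Int.add_mul_emod_self_left,
      Int.emod_eq_of_lt (by omega) (by omega)]
  · refine .inr ⟨?_, by omega⟩
    rw [show x - c = x % N - c + N + N * (x / N - 1) by rw [mul_sub]; omega,
      Int.add_mul_emod_self_left, Int.emod_eq_of_lt (by omega) (by omega)]

/-- The complement of a residue class modulo `k + 1`. -/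
theorem lineTiles_compl_residue {k : ℕ} (hk : 0 < k) {S : Set ℤ} {c : ℤ} (h₀ : 0 ≤ c)
    (h₁ : c < k + 1) (hS : ∀ x, x ∈ S ↔ x % (k + 1) ≠ c) : LineTiles (punctTile k 1 k) S := by
  refine lineTiles_periodic (N := 2 * (k + 1)) (c + 1)
    (fun t ht => by rw [mem_punctTile] at ht; omega) fun x => ?_
  rw [hS, mem_punctTile]
  have hx := sub_emod_cases (N := k + 1) (x := x) h₀ h₁
  have hx' := sub_emod_cases (N := k + 1) (c := 1) (x := x - c) (by omega) (by omega)
  have hr := Int.emod_nonneg x (by omega : (k + 1 : ℤ) ≠ 0)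
  have hr' := Int.emod_lt_of_pos x (by omega : (0 : ℤ) < k + 1)
  have hm := Int.emod_emod_of_dvd (x - c - 1) (Dvd.intro_left 2 rfl : (k + 1 : ℤ) ∣ 2 * (k + 1))
  rw [sub_sub x c 1] at hm hx'
  have hw := Int.emod_nonneg (x - (c + 1)) (by omega : (2 * (k + 1) : ℤ) ≠ 0)
  have hw' := Int.emod_lt_of_pos (x - (c + 1)) (by omega : (0 : ℤ) < 2 * (k + 1))
  generalize (x - (c + 1)) % (2 * (k + 1)) = w at *
  by_cases h : (k : ℤ) + 1 ≤ w
  · have e : w % (k + 1) = w - (k + 1) := by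
      rw [← Int.emod_eq_of_lt (a := w - (k + 1)) (b := k + 1) (by omega) (by omega)]
      simp
    omega
  · have e : w % (k + 1) = w := Int.emod_eq_of_lt hw (by omega)
    omega

theorem lineTiles_two_anchors {S : Set ℤ} (c e : ℤ)
    (hS : ∀ x, x ∈ S ↔ (x - c) % 12 ∈ punctTile 2 1 2 ∨ (x - e) % 12 ∈ punctTile 2 1 2)
    (hd : ∀ x : ℤ, (x - c) % 12 ∈ punctTile 2 1 2 → (x - e) % 12 ∉ punctTile 2 1 2) :
    LineTiles (punctTile 2 1 2) S := by
  have hT : ∀ t ∈ punctTile 2 1 2, 0 ≤ t ∧ t < 12 := fun t ht => by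
    rw [mem_punctTile] at ht
    omega
  have hS' : S = {x | (x - c) % 12 ∈ punctTile 2 1 2} ∪ {x | (x - e) % 12 ∈ punctTile 2 1 2} :=
    Set.ext hS
  rw [hS']
  exact (lineTiles_periodic c hT fun x => Iff.rfl).union (lineTiles_periodic e hT fun x => Iff.rfl)
    hd

theorem tilesZd_two : TilesZd 2 (punctTile 2 1 2) := by
  refine tilesZd_of_direction (fun p => if (p 0 % 12 = 3 ∨ p 0 % 12 = 6) ∧ p 1 % 3 ≠ 0 ∨
    (p 0 % 12 = 2 ∨ p 0 % 12 = 11) ∧ p 1 % 3 ≠ 1 ∨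
    (p 0 % 12 = 7 ∨ p 0 % 12 = 10) ∧ p 1 % 3 ≠ 2 then 1 else 0) fun i p => ?_
  fin_cases i
  · obtain h | h | h : p 1 % 3 = 0 ∨ p 1 % 3 = 1 ∨ p 1 % 3 = 2 := by omega
    · refine lineTiles_two_anchors 0 5 (fun x => ?_) fun x => ?_ <;>
        simp [mem_punctTile, h] <;> omega
    · refine lineTiles_two_anchors 1 8 (fun x => ?_) fun x => ?_ <;>
        simp [mem_punctTile, h] <;> omega
    · refine lineTiles_two_anchors 4 9 (fun x => ?_) fun x => ?_ <;>
        simp [mem_punctTile, h] <;> omega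
  · obtain h | h | h | h : (p 0 % 12 = 3 ∨ p 0 % 12 = 6) ∨ (p 0 % 12 = 2 ∨ p 0 % 12 = 11) ∨
        (p 0 % 12 = 7 ∨ p 0 % 12 = 10) ∨ ¬ ((p 0 % 12 = 3 ∨ p 0 % 12 = 6) ∨
        (p 0 % 12 = 2 ∨ p 0 % 12 = 11) ∨ (p 0 % 12 = 7 ∨ p 0 % 12 = 10)) := by omega
    · refine lineTiles_compl_residue (c := 0) ?_ ?_ ?_ fun y => ?_ <;> simp
      omega
    · refine lineTiles_compl_residue (c := 1) ?_ ?_ ?_ fun y => ?_ <;> simp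
      omega
    · refine lineTiles_compl_residue (c := 2) ?_ ?_ ?_ fun y => ?_ <;> simp
      omega
    · refine lineTiles_of_forall_notMem fun y => ?_
      simp
      omega

/-- Two families of subsets of `ℤ` from which a tiling of `ℤ³` can be built. -/
theorem tilesZd_three_of_families {k : ℕ} (hk : 2 ≤ k) (P Q : ℤ → Set ℤ)
    (hP : ∀ y, LineTiles (punctTile k 1 k) (P y)ᶜ) (hQ : ∀ y, LineTiles (punctTile k 1 k) (Q y)ᶜ)
    (hPQ : ∀ x, ∃ s : ℤ, 0 ≤ s ∧ s < k + 1 ∧ ∀ y, (x ∈ P y ↔ x ∈ Q y) ↔ y % (k + 1) ≠ s) :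
    TilesZd 3 (punctTile k 1 k) := by
  classical
  obtain ⟨A, hA⟩ : ∃ A : ℤ → Prop, ∀ z, A z ↔ z % (3 * k) = k ∨ 2 * k + 1 ≤ z % (3 * k) :=
    ⟨_, fun _ => Iff.rfl⟩
  obtain ⟨C, hC⟩ : ∃ C : ℤ → Prop, ∀ z, C z ↔
      z % (3 * k) = 0 ∨ k + 1 ≤ z % (3 * k) ∧ z % (3 * k) ≤ 2 * k - 1 := ⟨_, fun _ => Iff.rfl⟩
  refine tilesZd_of_direction (fun p =>
    if C (p 2) then if p 0 ∈ P (p 1) then 2 else 0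
    else if A (p 2) then if p 0 ∈ Q (p 1) then 2 else 0
    else if p 0 ∈ P (p 1) ↔ p 0 ∈ Q (p 1) then 1 else 2) fun i p => ?_
  have hk' : (0 : ℤ) < 3 * k := by omega
  have hlt : ∀ z : ℤ, 0 ≤ z % (3 * k) ∧ z % (3 * k) < 3 * k := fun z =>
    ⟨Int.emod_nonneg _ hk'.ne', Int.emod_lt_of_pos _ hk'⟩
  have hT : ∀ t ∈ punctTile k 1 k, 0 ≤ t ∧ t < 3 * (k : ℤ) := fun t ht => by
    rw [mem_punctTile] at ht
    omega
  fin_cases i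
  · by_cases h : C (p 2)
    · convert hP (p 1) using 1
      ext x
      simp [h]
    · by_cases h' : A (p 2)
      · convert hQ (p 1) using 1
        ext x
        simp [h, h']
      · refine lineTiles_of_forall_notMem fun x => ?_
        simp [h, h']
        split_ifs <;> simp
  · by_cases h : C (p 2)
    · refine lineTiles_of_forall_notMem fun y => ?_
      simp [h]
      split_ifs <;> simp
    · by_cases h' : A (p 2)
      · refine lineTiles_of_forall_notMem fun y => ?_
        simp [h, h']
        split_ifs <;> simp
      · obtain ⟨s, h₀, h₁, hs⟩ := hPQ (p 0)
        refine lineTiles_compl_residue (by omega) h₀ h₁ fun y => ?_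
        rw [← hs]
        simp [h, h']
  · by_cases h : p 0 ∈ P (p 1) <;> by_cases h' : p 0 ∈ Q (p 1)
    · refine lineTiles_periodic k hT fun z => ?_
      have := sub_emod_cases (N := 3 * k) (c := k) (x := z) (by omega) (by omega)
      have := hlt z
      simp [h, h', mem_punctTile, hA, hC]
      omega
    · refine lineTiles_periodic 0 hT fun z => ?_
      have := hlt z
      simp [h, h', mem_punctTile, hA, hC]
      omega
    · refine lineTiles_periodic (2 * k) hT fun z => ?_
      have := sub_emod_cases (N := 3 * k) (c := 2 * k) (x := z) (by omega) (by omega)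
      have := hlt z
      simp [h, h', mem_punctTile, hA, hC]
      omega
    · refine lineTiles_of_forall_notMem fun z => ?_
      simp [h, h']
      split_ifs <;> simp

theorem tilesZd_three_of_odd {k m : ℕ} (hm : 0 < m) (hk : k = 2 * m + 1) :
    TilesZd 3 (punctTile k 1 k) := by
  have hlt : ∀ y : ℤ, 0 ≤ y % (k + 1) ∧ y % (k + 1) < k + 1 := fun y =>
    ⟨Int.emod_nonneg _ (by omega), Int.emod_lt_of_pos _ (by omega)⟩
  refine tilesZd_three_of_families (by omega)
    (fun y => {x | x % (k + 1) = if y % (k + 1) ≤ m then 2 * (y % (k + 1)) else 0})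
    (fun y => {x | x % (k + 1) = if y % (k + 1) ≤ m then 2 * (y % (k + 1)) + 1 else 0})
    (fun y => lineTiles_compl_residue (by omega) ?_ ?_ fun x => Iff.rfl)
    (fun y => lineTiles_compl_residue (by omega) ?_ ?_ fun x => Iff.rfl) fun x => ?_
  · have := hlt y
    split_ifs <;> omega
  · have := hlt y
    split_ifs <;> omega
  · have := hlt y
    split_ifs <;> omega
  · have := hlt y
    split_ifs <;> omega
  · have := hlt x
    refine ⟨x % (k + 1) / 2, by omega, by omega, fun y => ?_⟩
    have := hlt y
    simp only [Set.mem_ofPred_eq]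
    split_ifs <;> omega

theorem tilesZd_three_of_even {k m : ℕ} (hm : 0 < m) (hk : k = 2 * m) :
    TilesZd 3 (punctTile k 1 k) := by
  have hlt : ∀ y : ℤ, 0 ≤ y % (k + 1) ∧ y % (k + 1) < k + 1 := fun y =>
    ⟨Int.emod_nonneg _ (by omega), Int.emod_lt_of_pos _ (by omega)⟩
  have hT : ∀ t ∈ punctTile k 1 k, 0 ≤ t ∧ t < 4 * (k : ℤ) := fun t ht => by
    rw [mem_punctTile] at ht
    omega
  obtain ⟨c, hc⟩ : ∃ c : ℤ → ℤ, ∀ s, c s = if s < m then 2 * s else 2 * s + k :=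
    ⟨_, fun _ => rfl⟩
  refine tilesZd_three_of_families (by omega)
    (fun y => {x | y % (k + 1) = k ∨ (x - c (y % (k + 1))) % (4 * k) ∉ punctTile k 1 k})
    (fun y => {x | y % (k + 1) = k ∨ (x - (c (y % (k + 1)) + 1)) % (4 * k) ∉ punctTile k 1 k})
    (fun y => ?_) (fun y => ?_) fun x => ?_
  · by_cases h : y % (k + 1) = k
    · exact lineTiles_of_forall_notMem fun x => by simp [h]
    · exact lineTiles_periodic (c (y % (k + 1))) hT fun x => by simp [h]
  · by_cases h : y % (k + 1) = k
    · exact lineTiles_of_forall_notMem fun x => by simp [h]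
    · exact lineTiles_periodic (c (y % (k + 1)) + 1) hT fun x => by simp [h]
  · have hr := Int.emod_nonneg x (by omega : (4 * k : ℤ) ≠ 0)
    have hr' := Int.emod_lt_of_pos x (by omega : (0 : ℤ) < 4 * k)
    obtain ⟨s, h₀, h₁, hs⟩ : ∃ s : ℤ, 0 ≤ s ∧ s < k ∧ ((s < m ∧ (x % (4 * k) = 2 * s ∨
        x % (4 * k) = 2 * s + k ∨ x % (4 * k) = 2 * s + k + 1 ∨ x % (4 * k) = 2 * s + 2 * k + 1)) ∨
        (m ≤ s ∧ (x % (4 * k) = 2 * s + k ∨ x % (4 * k) = 2 * s + 2 * k ∨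
        x % (4 * k) = 2 * s + 2 * k + 1 ∨ x % (4 * k) = 2 * s - k + 1))) := by
      generalize x % (4 * k) = r at *
      obtain h | h | h | h | h : r % 2 = 0 ∧ r < k ∨ k ≤ r ∧ r < 2 * k ∨
          r % 2 = 1 ∧ 2 * k < r ∧ r < 3 * k ∨ (r % 2 = 0 ∧ 2 * k ≤ r ∧ r < 3 * k) ∨
          (3 * k ≤ r ∨ r % 2 = 1 ∧ r < k) := by omega
      · exact ⟨r / 2, by omega⟩
      · exact ⟨(r - k) / 2, by omega⟩
      · exact ⟨(r - 2 * k - 1) / 2, by omega⟩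
      · exact ⟨(r - k) / 2, by omega⟩
      · obtain h | h := h
        · exact ⟨(r - 2 * k) / 2, by omega⟩
        · exact ⟨(r + k - 1) / 2, by omega⟩
    have key : ∀ u : ℤ, 0 ≤ u → u < k → (((x - c u) % (4 * k) ∈ punctTile k 1 k ↔
        (x - (c u + 1)) % (4 * k) ∈ punctTile k 1 k) ↔ u ≠ s) := by
      intro u hu hu'
      simp only [mem_punctTile, hc]
      split_ifs with hum
      · have e₁ := sub_emod_cases (N := 4 * k) (c := 2 * u) (x := x) (by omega) (by omega)
        have e₂ := sub_emod_cases (N := 4 * k) (c := 2 * u + 1) (x := x) (by omega) (by omega)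
        omega
      · have e₁ := sub_emod_cases (N := 4 * k) (c := 2 * u + k) (x := x) (by omega) (by omega)
        have e₂ := sub_emod_cases (N := 4 * k) (c := 2 * u + k + 1) (x := x) (by omega) (by omega)
        omega
    refine ⟨s, h₀, by omega, fun y => ?_⟩
    have := hlt y
    by_cases h : y % (k + 1) = k
    · simp [h]
      omega
    · rw [← key _ (by omega) (by omega)]
      simp [h, not_iff_not]

/-- The least `d` for which `k(1)k` tiles `ℤ^d` equals `min k 3`:
it tiles `ℤ^(min k 3)` and tiles no `ℤ^d` with `d < min k 3`. -/
theorem least_dim_symmetric_punctured_interval (k : ℕ) (hk : 0 < k) :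
    TilesZd (min k 3) (punctTile k 1 k) ∧
    ∀ d : ℕ, d < min k 3 → ¬ TilesZd d (punctTile k 1 k) := by
  refine ⟨?_, fun d hd => ?_⟩
  · obtain rfl | rfl | h : k = 1 ∨ k = 2 ∨ 3 ≤ k := by omega
    · exact tilesZd_one
    · exact tilesZd_two
    · rw [min_eq_right h]
      obtain h' | h' : k % 2 = 0 ∨ k % 2 = 1 := by omega
      · exact tilesZd_three_of_even (m := k / 2) (by omega) (by omega)
      · exact tilesZd_three_of_odd (m := k / 2) (by omega) (by omega)
  · obtain rfl | rfl | rfl : d = 0 ∨ d = 1 ∨ d = 2 := by omega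
    · exact not_tilesZd_zero _
    · exact not_tilesZd_one (by omega)
    · exact not_tilesZd_two (by omega)
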